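/- Let 𝙰, 𝙱 be admissible arrays whose types are pairwise disjoint ordinary finite subsets of ℕ*, which are compositions of (Σ_1, w_1) and (Σ_2, w_2) respectively, where Σ_1, Σ_2 are disjoint finite subsets of ℕ* with |Σ_1 ∪ Σ_2| < q. Then there exist finitely many elements α_1,…,α_m ∈ F_q and admissible arrays 𝙲_1,…,𝙲_m with pairwise disjoint ordinary finite types, each a composition of (Σ_1 ∪ Σ_2, w_1 + w_2), all independent of d, such that for all d ∈ ℕ: S_d†(𝙰) · S_{<d}†(𝙱) = Σ_{i=1}^{m} α_i S_d†(𝙲_i). -/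

import Mathlib

/-!
STATEMENT 12: Let `𝙰, 𝙱` be admissible arrays with pairwise disjoint ordinary
finite types, compositions of `(Σ₁, w₁)` and `(Σ₂, w₂)` respectively, where
`Σ₁, Σ₂` are disjoint finite subsets of `ℕ*` with `|Σ₁ ∪ Σ₂| < q`.  Then there
exist finitely many `α_1,…,α_m ∈ F_q` and admissible arrays `𝙲_1,…,𝙲_m` with
pairwise disjoint ordinary finite types, each a composition of
`(Σ₁ ∪ Σ₂, w₁ + w₂)`, all independent of `d`, such that for all `d ∈ ℕ`:
`S_d†(𝙰)·S_{<d}†(𝙱) = Σ_i α_i S_d†(𝙲_i)` in the polynomial ring over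
`K = F_q(θ)` in the indeterminates `t_n`.
-/

open Polynomial Finset

noncomputable section

variable (Fq : Type) [Field Fq] [Fintype Fq]

/-- `q`, the cardinality of the base field. -/
abbrev q := Fintype.card Fq

/-- `θ` as an element of `K = F_q(θ)`. -/
def th : RatFunc Fq := algebraMap (Polynomial Fq) (RatFunc Fq) Polynomial.X

/-- `a` as an element of `K`. -/
def aK (a : Polynomial Fq) : RatFunc Fq := algebraMap (Polynomial Fq) (RatFunc Fq) a

/-- The canonical map `F_q → K`. -/
def FqK : Fq →+* RatFunc Fq :=
  (algebraMap (Polynomial Fq) (RatFunc Fq)).comp Polynomial.C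

/-- The monic polynomial `θ^d + Σ_{i<d} c_i θ^i`; as `c` ranges over `Fin d → Fq`
these are exactly the elements of `A^+(d)`. -/
def mP (d : ℕ) (c : Fin d → Fq) : Polynomial Fq :=
  Polynomial.X ^ d + ∑ i : Fin d, Polynomial.C (c i) * Polynomial.X ^ (i : ℕ)

/-- `a(t_i)`: substitute `θ` by the indeterminate `t_i` in `a ∈ A`. -/
def tval (i : ℕ+) (a : Polynomial Fq) : MvPolynomial ℕ+ (RatFunc Fq) :=
  Polynomial.eval₂ ((MvPolynomial.C : RatFunc Fq →+* MvPolynomial ℕ+ (RatFunc Fq)).comp (FqK Fq))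
    (MvPolynomial.X i) a

/-- The scalar power sum `S_d(s) = Σ_{a∈A^+(d)} a^{−s} ∈ K`. -/
def Ssc (d : ℕ) (s : ℕ) : RatFunc Fq := ∑ c : Fin d → Fq, ((aK Fq (mP Fq d c)) ^ s)⁻¹

/-- `b_d(t_i) = ∏_{m<d} (t_i − θ^{q^m})` as a polynomial in the variable `t_i`. -/
def bMv (d : ℕ) (i : ℕ+) : MvPolynomial ℕ+ (RatFunc Fq) :=
  ∏ m ∈ Finset.range d, (MvPolynomial.X i - MvPolynomial.C (th Fq ^ q Fq ^ m))

/-- The depth-one power sum `S_d(Σ; s) = Σ_{a∈A^+(d)} χ_Σ(a)/a^s`, where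
`χ_Σ(a) = ∏_{i∈Σ} a(t_i)` for an ordinary finite subset `Σ` of `ℕ*`. -/
def S1F (d : ℕ) (Sg : Finset ℕ+) (s : ℕ) : MvPolynomial ℕ+ (RatFunc Fq) :=
  ∑ c : Fin d → Fq, (∏ i ∈ Sg, tval Fq i (mP Fq d c)) *
    MvPolynomial.C ((aK Fq (mP Fq d c)) ^ s)⁻¹

/-- The depth-one dagger power sum `S_d†(Σ; s) = S_d(s)·b_d(Σ)`, with
`b_d(Σ) = ∏_{i∈Σ} b_d(t_i)`. -/
def S1D (d : ℕ) (Sg : Finset ℕ+) (s : ℕ) : MvPolynomial ℕ+ (RatFunc Fq) :=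
  MvPolynomial.C (Ssc Fq d s) * ∏ i ∈ Sg, bMv Fq d i

/-- Power sums of arrays with ordinary finite types (lists of pairs `(Σ_i, s_i)`):
`S_d(𝙰) = Σ_{d = d_1 > … > d_r ≥ 0} ∏_i S_{d_i}(Σ_i; s_i)`. -/
def SPF : List (Finset ℕ+ × ℕ) → ℕ → MvPolynomial ℕ+ (RatFunc Fq)
  | [], d => if d = 0 then 1 else 0
  | [x], d => S1F Fq d x.1 x.2
  | x :: y :: L, d => S1F Fq d x.1 x.2 * ∑ k ∈ Finset.range d, SPF (y :: L) k

/-- Dagger power sums of arrays with ordinary finite types: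
`S_d†(𝙰) = Σ_{d = d_1 > … > d_r ≥ 0} ∏_i S_{d_i}(s_i) b_{d_i}(Σ_i)`. -/
def SPD : List (Finset ℕ+ × ℕ) → ℕ → MvPolynomial ℕ+ (RatFunc Fq)
  | [], d => if d = 0 then 1 else 0
  | [x], d => S1D Fq d x.1 x.2
  | x :: y :: L, d => S1D Fq d x.1 x.2 * ∑ k ∈ Finset.range d, SPD (y :: L) k

/-- `𝙰` is an admissible array (with pairwise disjoint ordinary finite types)
which is a composition of `(Σ, w)`: all exponents are positive, the types are
pairwise disjoint with union `Σ`, and the exponents add up to `w`. -/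
def IsCompF (L : List (Finset ℕ+ × ℕ)) (Sg : Finset ℕ+) (w : ℕ) : Prop :=
  (∀ x ∈ L, 1 ≤ x.2) ∧ L.Pairwise (fun x y => Disjoint x.1 y.1) ∧
    (L.map Prod.fst).foldr (· ∪ ·) ∅ = Sg ∧ (L.map Prod.snd).sum = w

set_option linter.unusedSectionVars false

/-! ### Partial fractions and the product of two scalar power sums -/

/-- Partial fractions, in terms of `u = 1/x`, `v = 1/y`, `g = 1/(x - y)`. -/
theorem exists_partialFraction (R : Type*) [CommRing R] (n : ℕ) :
    ∀ a b : ℕ, a + b = n + 1 → ∃ α β : ℕ → ℤ, ∀ u v g : R, u * v = g * (v - u) →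
      u ^ a * v ^ b = ∑ j ∈ range (n + 1),
        g ^ j * (α j * u ^ (n + 1 - j) + β j * v ^ (n + 1 - j)) := by
  induction n with
  | zero =>
    intro a b hab
    obtain ⟨rfl, rfl⟩ | ⟨rfl, rfl⟩ : (a = 0 ∧ b = 1) ∨ (a = 1 ∧ b = 0) := by omega
    · exact ⟨0, 1, fun u v g _ => by simp⟩
    · exact ⟨1, 0, fun u v g _ => by simp⟩
  | succ n ih =>
    intro a b hab
    rcases a with _ | a
    · obtain rfl : b = n + 2 := by omega
      refine ⟨0, Pi.single 0 1, fun u v g _ => ?_⟩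
      rw [Finset.sum_range_succ']
      simp
    rcases b with _ | b
    · obtain rfl : a = n + 1 := by omega
      refine ⟨Pi.single 0 1, 0, fun u v g _ => ?_⟩
      rw [Finset.sum_range_succ']
      simp
    obtain ⟨α₁, β₁, h₁⟩ := ih a (b + 1) (by omega)
    obtain ⟨α₂, β₂, h₂⟩ := ih (a + 1) b (by omega)
    refine ⟨fun j => if j = 0 then 0 else α₁ (j - 1) - α₂ (j - 1),
      fun j => if j = 0 then 0 else β₁ (j - 1) - β₂ (j - 1), fun u v g h => ?_⟩
    have key : u ^ (a + 1) * v ^ (b + 1) = g * (u ^ a * v ^ (b + 1) - u ^ (a + 1) * v ^ b) := by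
      linear_combination (u ^ a * v ^ b) * h
    rw [key, h₁ u v g h, h₂ u v g h, ← Finset.sum_sub_distrib, Finset.mul_sum]
    conv_rhs => rw [Finset.sum_range_succ']
    simp only [if_true, Nat.add_eq_zero_iff, one_ne_zero, and_false, if_false,
      Nat.add_sub_cancel, Int.cast_zero, zero_mul, add_zero, mul_zero]
    refine Finset.sum_congr rfl fun j _ => ?_
    rw [show n + 1 + 1 - (j + 1) = n + 1 - j by omega]
    push_cast
    ring

/-- Partial fractions with both exponents positive: every term carries a positive power of `g`. -/
theorem exists_partialFraction_succ (R : Type*) [CommRing R] (a b : ℕ) :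
    ∃ α β : ℕ → ℤ, ∀ u v g : R, u * v = g * (v - u) →
      u ^ (a + 1) * v ^ (b + 1) = ∑ j ∈ range (a + b + 1),
        g ^ (j + 1) * (α j * u ^ (a + b + 1 - j) + β j * v ^ (a + b + 1 - j)) := by
  obtain ⟨α₁, β₁, h₁⟩ := exists_partialFraction R (a + b) a (b + 1) (by omega)
  obtain ⟨α₂, β₂, h₂⟩ := exists_partialFraction R (a + b) (a + 1) b (by omega)
  refine ⟨fun j => α₁ j - α₂ j, fun j => β₁ j - β₂ j, fun u v g h => ?_⟩
  have key : u ^ (a + 1) * v ^ (b + 1) = g * (u ^ a * v ^ (b + 1) - u ^ (a + 1) * v ^ b) := by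
    linear_combination (u ^ a * v ^ b) * h
  rw [key, h₁ u v g h, h₂ u v g h, ← Finset.sum_sub_distrib, Finset.mul_sum]
  refine Finset.sum_congr rfl fun j _ => ?_
  push_cast
  ring

/-- The polynomial `Σ_{i<d} c_i θ^i` as an element of `K`. -/
def lowK (d : ℕ) (c : Fin d → Fq) : RatFunc Fq := ∑ i, FqK Fq (c i) * th Fq ^ (i : ℕ)

theorem aK_mP (d : ℕ) (c : Fin d → Fq) : aK Fq (mP Fq d c) = th Fq ^ d + lowK Fq d c := by
  simp [aK, mP, lowK, th, FqK]

theorem aK_mP_ne_zero (d : ℕ) (c : Fin d → Fq) : aK Fq (mP Fq d c) ≠ 0 := by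
  have hm : (mP Fq d c).Monic := by
    refine Polynomial.monic_X_pow_add ?_
    refine (Polynomial.degree_sum_le _ _).trans_lt ?_
    refine (Finset.sup_lt_iff (WithBot.bot_lt_coe d)).2 fun i _ => ?_
    refine (Polynomial.degree_C_mul_X_pow_le _ _).trans_lt ?_
    exact WithBot.coe_lt_coe.2 i.2
  simpa [aK] using hm.ne_zero

theorem aK_mP_sub (d : ℕ) (c c' : Fin d → Fq) :
    aK Fq (mP Fq d c) - aK Fq (mP Fq d c') = lowK Fq d (c - c') := by
  simp [aK_mP, lowK, sub_mul]

theorem aK_mP_injective (d : ℕ) : Function.Injective fun c => aK Fq (mP Fq d c) := by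
  intro c c' h
  have h' : mP Fq d c = mP Fq d c' := by
    simpa [aK] using h
  funext i
  have := congrArg (fun p => p.coeff (i : ℕ)) h'
  simpa [mP, Polynomial.coeff_X_pow, Polynomial.finsetSum_coeff, Fin.val_inj] using this

theorem lowK_snoc (d : ℕ) (c : Fin d → Fq) (x : Fq) :
    lowK Fq (d + 1) (Fin.snoc (α := fun _ => Fq) c x) = lowK Fq d c + FqK Fq x * th Fq ^ d := by
  simp [lowK, Fin.sum_univ_castSucc]

theorem lowK_smul (d : ℕ) (c : Fin d → Fq) (x : Fq) :
    lowK Fq d (x • c) = FqK Fq x * lowK Fq d c := by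
  simp [lowK, Finset.mul_sum, mul_assoc]

open Classical in
theorem sum_lowK_inv_pow (j d : ℕ) :
    ∑ e : Fin d → Fq, (lowK Fq d e)⁻¹ ^ (j + 1) =
      FqK Fq (∑ x ∈ univ.erase (0 : Fq), x⁻¹ ^ (j + 1)) *
        ∑ k ∈ range d, Ssc Fq k (j + 1) := by
  induction d with
  | zero => simp [lowK]
  | succ d ih =>
    have hx : ∀ x ∈ univ.erase (0 : Fq),
        ∑ c : Fin d → Fq, (lowK Fq (d + 1) (Fin.snoc (α := fun _ => Fq) c x))⁻¹ ^ (j + 1) =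
          FqK Fq (x⁻¹ ^ (j + 1)) * Ssc Fq d (j + 1) := by
      intro x hx
      have hx0 : x ≠ 0 := by simpa using hx
      rw [Ssc, Finset.mul_sum,
        ← (MulAction.bijective (β := Fin d → Fq) (Units.mk0 x hx0)).sum_comp]
      refine Finset.sum_congr rfl fun c _ => ?_
      rw [lowK_snoc, Units.smul_mk0, lowK_smul, aK_mP, ← mul_add, mul_inv, mul_pow, map_pow,
        map_inv₀, add_comm (lowK Fq d c), inv_pow (_ + _)]
    rw [← (Fin.snocEquiv fun _ : Fin (d + 1) => Fq).sum_comp, Fintype.sum_prod_type,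
      ← Finset.add_sum_erase _ _ (Finset.mem_univ (0 : Fq)), Finset.sum_range_succ, mul_add, ← ih,
      map_sum, Finset.sum_mul]
    congr 1
    · refine Finset.sum_congr rfl fun c _ => ?_
      have := lowK_snoc Fq d c 0
      simp only [map_zero, zero_mul, add_zero] at this
      exact congrArg (fun z => z⁻¹ ^ (j + 1)) this
    · exact Finset.sum_congr rfl hx

/-- The product formula for two scalar power sums of the same degree. -/
theorem exists_Ssc_mul_Ssc (a b : ℕ) : ∃ δ : ℕ → Fq, ∀ d : ℕ,
    Ssc Fq d (a + 1) * Ssc Fq d (b + 1) = Ssc Fq d (a + b + 2) +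
      ∑ j ∈ range (a + b + 1), FqK Fq (δ j) *
        (Ssc Fq d (a + b + 1 - j) * ∑ k ∈ range d, Ssc Fq k (j + 1)) := by
  classical
  obtain ⟨α, β, h⟩ := exists_partialFraction_succ (RatFunc Fq) a b
  refine ⟨fun j => ((α j + β j : ℤ) : Fq) * ∑ x ∈ univ.erase (0 : Fq), x⁻¹ ^ (j + 1),
    fun d => ?_⟩
  set N : (Fin d → Fq) → RatFunc Fq := fun c => (aK Fq (mP Fq d c))⁻¹ with hN
  have hS : ∀ s, Ssc Fq d s = ∑ c, N c ^ s := fun s => by simp [Ssc, hN]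
  have term : ∀ c c', N c ^ (a + 1) * N c' ^ (b + 1) =
      (if c' = c then N c ^ (a + b + 2) else 0) +
        ∑ j ∈ range (a + b + 1), (lowK Fq d (c - c'))⁻¹ ^ (j + 1) *
          (α j * N c ^ (a + b + 1 - j) + β j * N c' ^ (a + b + 1 - j)) := by
    intro c c'
    by_cases hc : c' = c
    · subst hc
      have h0 : lowK Fq d 0 = 0 := by simp [lowK]
      simp only [if_true, sub_self, h0, inv_zero]
      rw [Finset.sum_eq_zero fun j _ => by simp]
      ring
    · rw [if_neg hc, zero_add]
      refine h _ _ _ ?_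
      have h1 := aK_mP_ne_zero Fq d c
      have h2 := aK_mP_ne_zero Fq d c'
      have h3 : aK Fq (mP Fq d c) - aK Fq (mP Fq d c') ≠ 0 :=
        sub_ne_zero.2 fun e => hc (aK_mP_injective Fq d e).symm
      rw [← aK_mP_sub]
      simp only [hN]
      field_simp
  have hL : ∀ s j, ∑ c, ∑ c', (lowK Fq d (c - c'))⁻¹ ^ j * N c ^ s =
      (∑ e, (lowK Fq d e)⁻¹ ^ j) * ∑ c, N c ^ s := by
    intro s j
    rw [Finset.mul_sum]
    refine Finset.sum_congr rfl fun c _ => ?_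
    rw [← Finset.sum_mul, ← (Equiv.subLeft c).sum_comp fun e => (lowK Fq d e)⁻¹ ^ j]
    rfl
  have hR : ∀ s j, ∑ c, ∑ c', (lowK Fq d (c - c'))⁻¹ ^ j * N c' ^ s =
      (∑ e, (lowK Fq d e)⁻¹ ^ j) * ∑ c, N c ^ s := by
    intro s j
    rw [Finset.sum_comm, Finset.mul_sum]
    refine Finset.sum_congr rfl fun c _ => ?_
    rw [← Finset.sum_mul, ← (Equiv.subRight c).sum_comp fun e => (lowK Fq d e)⁻¹ ^ j]
    rfl
  rw [hS, hS, Finset.sum_mul_sum]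
  simp only [term, Finset.sum_add_distrib]
  congr 1
  · simp [hS]
  · calc _ = ∑ j ∈ range (a + b + 1), ∑ c, ∑ c', (lowK Fq d (c - c'))⁻¹ ^ (j + 1) *
          (α j * N c ^ (a + b + 1 - j) + β j * N c' ^ (a + b + 1 - j)) := by
          simp only [Finset.sum_comm (s := univ) (t := range (a + b + 1))]
      _ = _ := by
          refine Finset.sum_congr rfl fun j _ => ?_
          simp only [mul_add, mul_left_comm _ (α j : RatFunc Fq), mul_left_comm _ (β j : RatFunc Fq),
            Finset.sum_add_distrib]
          simp only [← Finset.mul_sum, hL, hR]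
          rw [sum_lowK_inv_pow, hS]
          simp only [map_mul, map_intCast]
          push_cast
          ring

/-! ### Compositions -/

theorem disjoint_foldr_union {X : Finset ℕ+} {L : List (Finset ℕ+)} :
    Disjoint X (L.foldr (· ∪ ·) ∅) ↔ ∀ Y ∈ L, Disjoint X Y := by
  induction L with
  | nil => simp
  | cons Y L ih => simp [ih]

theorem isCompF_cons {x : Finset ℕ+ × ℕ} {L : List (Finset ℕ+ × ℕ)} {Sg : Finset ℕ+} {w : ℕ} :
    IsCompF (x :: L) Sg w ↔ ∃ Sg' w', IsCompF L Sg' w' ∧ 1 ≤ x.2 ∧ Disjoint x.1 Sg' ∧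
      x.1 ∪ Sg' = Sg ∧ x.2 + w' = w := by
  constructor
  · rintro ⟨h1, h2, h3, h4⟩
    rw [List.pairwise_cons] at h2
    refine ⟨_, _, ⟨fun y hy => h1 y (List.mem_cons_of_mem _ hy), h2.2, rfl, rfl⟩,
      h1 x List.mem_cons_self, ?_, h3, by simpa using h4⟩
    rw [disjoint_foldr_union]
    simpa using h2.1
  · rintro ⟨Sg', w', ⟨h1, h2, rfl, rfl⟩, hx, hd, rfl, rfl⟩
    rw [disjoint_foldr_union] at hd
    refine ⟨by simpa using ⟨hx, by simpa using h1⟩, List.pairwise_cons.2 ⟨?_, h2⟩, rfl, by simp⟩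
    simpa using hd

theorem isCompF_nil {Sg : Finset ℕ+} {w : ℕ} : IsCompF [] Sg w ↔ Sg = ∅ ∧ w = 0 := by
  simp [IsCompF, eq_comm]

/-! ### Spans of dagger power sums -/

/-- The truncated dagger sum `S_{<d}†(𝙰)`, normalized to `1` for the empty array. -/
def SLD : List (Finset ℕ+ × ℕ) → ℕ → MvPolynomial ℕ+ (RatFunc Fq)
  | [], _ => 1
  | x :: L, d => ∑ k ∈ range d, SPD Fq (x :: L) k

theorem SPD_cons (x : Finset ℕ+ × ℕ) (L : List (Finset ℕ+ × ℕ)) (d : ℕ) :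
    SPD Fq (x :: L) d = S1D Fq d x.1 x.2 * SLD Fq L d := by
  cases L <;> simp [SPD, SLD]

/-- The `F_q`-span of the sequences `S_d†(𝙲)`, for `𝙲` a composition of `(Σ, w)`. -/
def spanSPD (Sg : Finset ℕ+) (w : ℕ) : Submodule Fq (ℕ → MvPolynomial ℕ+ (RatFunc Fq)) :=
  Submodule.span Fq {f | ∃ C, IsCompF C Sg w ∧ SPD Fq C = f}

/-- The `F_q`-span of the sequences `S_{<d}†(𝙲)`, for `𝙲` a composition of `(Σ, w)`. -/
def spanSLD (Sg : Finset ℕ+) (w : ℕ) : Submodule Fq (ℕ → MvPolynomial ℕ+ (RatFunc Fq)) :=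
  Submodule.span Fq {f | ∃ C, IsCompF C Sg w ∧ SLD Fq C = f}

theorem SLD_mem_spanSLD {C : List (Finset ℕ+ × ℕ)} {Sg : Finset ℕ+} {w : ℕ}
    (h : IsCompF C Sg w) : SLD Fq C ∈ spanSLD Fq Sg w :=
  Submodule.subset_span ⟨C, h, rfl⟩

theorem S1D_mul_mem_spanSPD {X Sg : Finset ℕ+} {s w : ℕ} (hs : 1 ≤ s) (hd : Disjoint X Sg)
    {f : ℕ → MvPolynomial ℕ+ (RatFunc Fq)} (hf : f ∈ spanSLD Fq Sg w) :
    (fun d => S1D Fq d X s * f d) ∈ spanSPD Fq (X ∪ Sg) (s + w) := by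
  suffices h : spanSLD Fq Sg w ≤ (spanSPD Fq (X ∪ Sg) (s + w)).comap
      (LinearMap.mulLeft Fq fun d => S1D Fq d X s) from h hf
  refine Submodule.span_le.2 ?_
  rintro _ ⟨C, hC, rfl⟩
  refine Submodule.subset_span ⟨(X, s) :: C, isCompF_cons.2 ⟨_, _, hC, hs, hd, rfl, rfl⟩, ?_⟩
  funext d
  exact SPD_cons Fq _ _ _

/-- Partial summation `f ↦ (d ↦ Σ_{k<d} f k)` as a linear map. -/
def partialSum : (ℕ → MvPolynomial ℕ+ (RatFunc Fq)) →ₗ[Fq] ℕ → MvPolynomial ℕ+ (RatFunc Fq) where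
  toFun f d := ∑ k ∈ range d, f k
  map_add' f g := by funext d; simp [Finset.sum_add_distrib]
  map_smul' c f := by funext d; simp [Finset.smul_sum]

theorem partialSum_mem_spanSLD {Sg : Finset ℕ+} {w : ℕ} (hw : 1 ≤ w)
    {f : ℕ → MvPolynomial ℕ+ (RatFunc Fq)} (hf : f ∈ spanSPD Fq Sg w) :
    partialSum Fq f ∈ spanSLD Fq Sg w := by
  suffices h : spanSPD Fq Sg w ≤ (spanSLD Fq Sg w).comap (partialSum Fq) from h hf
  refine Submodule.span_le.2 ?_
  rintro _ ⟨C, hC, rfl⟩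
  refine Submodule.subset_span ⟨C, hC, ?_⟩
  cases C with
  | nil => have := (isCompF_nil.1 hC).2; omega
  | cons x L => rfl

theorem C_FqK_mul (x : Fq) (f : MvPolynomial ℕ+ (RatFunc Fq)) :
    MvPolynomial.C (FqK Fq x) * f = x • f := by
  rw [← MvPolynomial.smul_eq_C_mul, ← algebraMap_smul (RatFunc Fq) x f]
  congr 1

theorem sum_range_mul_sum_range {R : Type*} [CommRing R] (f g : ℕ → R) (d : ℕ) :
    (∑ k ∈ range d, f k) * ∑ k ∈ range d, g k =
      ∑ k ∈ range d, (f k * ∑ i ∈ range k, g i + g k * ∑ i ∈ range k, f i + f k * g k) := by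
  induction d with
  | zero => simp
  | succ d ih =>
    rw [Finset.sum_range_succ _ d, Finset.sum_range_succ _ d, Finset.sum_range_succ _ d, ← ih]
    ring

theorem exists_S1D_mul_S1D {X Y : Finset ℕ+} (h : Disjoint X Y) (a b : ℕ) :
    ∃ δ : ℕ → Fq, ∀ d : ℕ, S1D Fq d X (a + 1) * S1D Fq d Y (b + 1) =
      S1D Fq d (X ∪ Y) (a + b + 2) + ∑ j ∈ range (a + b + 1),
        δ j • (S1D Fq d (X ∪ Y) (a + b + 1 - j) * SLD Fq [(∅, j + 1)] d) := by
  obtain ⟨δ, hδ⟩ := exists_Ssc_mul_Ssc Fq a b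
  refine ⟨δ, fun d => ?_⟩
  have hs : ∀ j, SLD Fq [(∅, j + 1)] d = MvPolynomial.C (∑ k ∈ range d, Ssc Fq k (j + 1)) := by
    intro j
    simp [SLD, SPD, S1D]
  have hC := congrArg (MvPolynomial.C (σ := ℕ+)) (hδ d)
  simp only [map_mul, map_add, map_sum (MvPolynomial.C (σ := ℕ+)) _ (range (a + b + 1))] at hC
  simp only [S1D, Finset.prod_union h, hs, ← C_FqK_mul]
  rw [mul_mul_mul_comm, hC, add_mul, Finset.sum_mul]
  refine congrArg₂ (· + ·) rfl (Finset.sum_congr rfl fun j _ => ?_)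
  ring

theorem spanSLD_mul_le (n : ℕ) : ∀ (w₁ w₂ : ℕ), w₁ + w₂ = n → ∀ Sg₁ Sg₂ : Finset ℕ+,
    Disjoint Sg₁ Sg₂ →
      spanSLD Fq Sg₁ w₁ * spanSLD Fq Sg₂ w₂ ≤ spanSLD Fq (Sg₁ ∪ Sg₂) (w₁ + w₂) := by
  induction n using Nat.strong_induction_on with
  | _ n ih =>
  have mul_mem : ∀ {w₁ w₂ : ℕ} {Sg₁ Sg₂ : Finset ℕ+} {f g : ℕ → MvPolynomial ℕ+ (RatFunc Fq)},
      w₁ + w₂ < n → Disjoint Sg₁ Sg₂ → f ∈ spanSLD Fq Sg₁ w₁ → g ∈ spanSLD Fq Sg₂ w₂ →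
        f * g ∈ spanSLD Fq (Sg₁ ∪ Sg₂) (w₁ + w₂) := fun hlt hd hf hg =>
    ih _ hlt _ _ rfl _ _ hd (Submodule.mul_mem_mul hf hg)
  rintro w₁ w₂ rfl Sg₁ Sg₂ hdisj
  rw [spanSLD, spanSLD, Submodule.span_mul_span]
  refine Submodule.span_le.2 ?_
  rintro _ ⟨_, ⟨A, hA, rfl⟩, _, ⟨B, hB, rfl⟩, rfl⟩
  change SLD Fq A * SLD Fq B ∈ spanSLD Fq (Sg₁ ∪ Sg₂) (w₁ + w₂)
  rcases A with _ | ⟨⟨X, s⟩, A⟩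
  · obtain ⟨rfl, rfl⟩ := isCompF_nil.1 hA
    have h1 : SLD Fq [] = 1 := rfl
    rw [h1, one_mul, Finset.empty_union, zero_add]
    exact SLD_mem_spanSLD Fq hB
  rcases B with _ | ⟨⟨Y, r⟩, B⟩
  · obtain ⟨rfl, rfl⟩ := isCompF_nil.1 hB
    have h1 : SLD Fq [] = 1 := rfl
    rw [h1, mul_one, Finset.union_empty, add_zero]
    exact SLD_mem_spanSLD Fq hA
  have hA₀ := SLD_mem_spanSLD Fq hA
  have hB₀ := SLD_mem_spanSLD Fq hB
  obtain ⟨T₁, v₁, hA', hs, hXT, rfl, rfl⟩ := isCompF_cons.1 hA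
  obtain ⟨T₂, v₂, hB', hr, hYT, rfl, rfl⟩ := isCompF_cons.1 hB
  simp only at hs hr hXT hYT hdisj mul_mem hA₀ hB₀ ⊢
  have hA₁ := SLD_mem_spanSLD Fq hA'
  have hB₁ := SLD_mem_spanSLD Fq hB'
  simp only [Finset.disjoint_union_left, Finset.disjoint_union_right] at hdisj
  obtain ⟨⟨hXY, hTY⟩, hXT₂, hTT⟩ := hdisj
  obtain ⟨a, rfl⟩ : ∃ a, s = a + 1 := ⟨s - 1, by omega⟩
  obtain ⟨b, rfl⟩ : ∃ b, r = b + 1 := ⟨r - 1, by omega⟩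
  obtain ⟨δ, hδ⟩ := exists_S1D_mul_S1D Fq hXY a b
  have hprod : SLD Fq ((X, a + 1) :: A) * SLD Fq ((Y, b + 1) :: B) = partialSum Fq
      ((fun d => S1D Fq d X (a + 1) * (SLD Fq A * SLD Fq ((Y, b + 1) :: B)) d) +
        (fun d => S1D Fq d Y (b + 1) * (SLD Fq ((X, a + 1) :: A) * SLD Fq B) d) +
        ((fun d => S1D Fq d (X ∪ Y) (a + b + 2) * (SLD Fq A * SLD Fq B) d) +
          ∑ j ∈ range (a + b + 1), δ j • fun d => S1D Fq d (X ∪ Y) (a + b + 1 - j) *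
            (SLD Fq [(∅, j + 1)] * (SLD Fq A * SLD Fq B)) d)) := by
    funext d
    refine (sum_range_mul_sum_range _ _ d).trans (Finset.sum_congr rfl fun k _ => ?_)
    simp only [Pi.add_apply, Finset.sum_apply, Pi.smul_apply, Pi.mul_apply]
    congr 1
    · rw [SPD_cons, SPD_cons, mul_assoc, mul_assoc, mul_comm (SLD Fq ((X, a + 1) :: A) k)]
      rfl
    · rw [SPD_cons, SPD_cons, mul_mul_mul_comm, hδ k, add_mul, Finset.sum_mul]
      congr 1
      refine Finset.sum_congr rfl fun j _ => ?_
      rw [smul_mul_assoc, mul_assoc]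
  rw [hprod]
  refine partialSum_mem_spanSLD Fq (by omega) (Submodule.add_mem _ (Submodule.add_mem _ ?_ ?_)
    (Submodule.add_mem _ ?_ (Submodule.sum_mem _ fun j hj => Submodule.smul_mem _ _ ?_)))
  · have := S1D_mul_mem_spanSPD Fq hs (X := X) (by simp [hXY, hXT, hXT₂])
      (mul_mem (by omega) (by simp [hTY, hTT]) hA₁ hB₀)
    convert this using 2
    · simp only [Finset.union_assoc]
    · omega
  · have := S1D_mul_mem_spanSPD Fq hr (X := Y) (by simp [hXY.symm, hYT, hTY.symm])
      (mul_mem (by omega) (by simp [hXT₂, hTT]) hA₀ hB₁)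
    convert this using 2
    · ext; simp only [Finset.mem_union]; tauto
    · omega
  · have := S1D_mul_mem_spanSPD Fq (s := a + b + 2) (X := X ∪ Y) (by omega)
      (by simp [hXT, hXT₂, hYT, hTY.symm]) (mul_mem (by omega) hTT hA₁ hB₁)
    convert this using 2
    · ext; simp only [Finset.mem_union]; tauto
    · omega
  · have hj' : j < a + b + 1 := Finset.mem_range.1 hj
    have hcomp : IsCompF [(∅, j + 1)] ∅ (j + 1) := by simp [IsCompF]
    have := S1D_mul_mem_spanSPD Fq (s := a + b + 1 - j) (X := X ∪ Y) (by omega)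
      (by simp [hXT, hXT₂, hYT, hTY.symm]) (mul_mem (by omega) (Finset.disjoint_empty_left _)
        (SLD_mem_spanSLD Fq hcomp) (mul_mem (by omega) hTT hA₁ hB₁))
    convert this using 2
    · ext; simp only [Finset.mem_union, Finset.notMem_empty]; tauto
    · omega

theorem statement12 (Sg1 Sg2 : Finset ℕ+) (hdisj : Disjoint Sg1 Sg2)
    (hcard : (Sg1 ∪ Sg2).card < q Fq) (w1 w2 : ℕ) (hw1 : 1 ≤ w1) (hw2 : 1 ≤ w2)
    (A B : List (Finset ℕ+ × ℕ)) (hA : IsCompF A Sg1 w1) (hB : IsCompF B Sg2 w2) :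
    ∃ (m : ℕ) (α : Fin m → Fq) (Cs : Fin m → List (Finset ℕ+ × ℕ)),
      (∀ i, IsCompF (Cs i) (Sg1 ∪ Sg2) (w1 + w2)) ∧
      ∀ d : ℕ, SPD Fq A d * (∑ k ∈ Finset.range d, SPD Fq B k) =
        ∑ i, MvPolynomial.C (FqK Fq (α i)) * SPD Fq (Cs i) d := by
  rcases A with _ | ⟨⟨X, s⟩, A⟩
  · have := (isCompF_nil.1 hA).2
    omega
  rcases B with _ | ⟨y, B⟩
  · have := (isCompF_nil.1 hB).2
    omega
  obtain ⟨T, v, hA', hs, hXT, rfl, rfl⟩ := isCompF_cons.1 hA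
  rw [Finset.disjoint_union_left] at hdisj
  have hmem := S1D_mul_mem_spanSPD Fq hs (X := X)
    (Finset.disjoint_union_right.2 ⟨hXT, hdisj.1⟩)
    (spanSLD_mul_le Fq _ _ _ rfl _ _ hdisj.2
      (Submodule.mul_mem_mul (SLD_mem_spanSLD Fq hA') (SLD_mem_spanSLD Fq hB)))
  obtain ⟨m, α, g, hg⟩ := Submodule.mem_span_set'.1 hmem
  choose Cs hCs hCs' using fun i => (g i).2
  refine ⟨m, α, Cs, fun i => ?_, fun d => ?_⟩
  · simpa only [Finset.union_assoc, add_assoc] using hCs i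
  · have := congrFun hg d
    simp only [Finset.sum_apply, Pi.smul_apply, Pi.mul_apply, ← hCs'] at this
    simp only [C_FqK_mul, this, SPD_cons Fq (X, s), mul_assoc]
    rfl

end
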